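/- There is no pair of twice differentiable functions t, x : [0,∞) → ℝ satisfying t''(s) = −exp(2·t(s))·(x'(s))² and x''(s) = −2·t'(s)·x'(s) for all s ≥ 0, together with the initial conditions −(t'(0))² + exp(2·t(0))·(x'(0))² = −1, t'(0) < 0, and x'(0) ≠ 0. -/

import Mathlib

/-- A real function on `[0,∞)` with vanishing derivative is constant. -/
theorem eq_apply_zero_of_hasDerivWithinAt_zero {f : ℝ → ℝ}
    (hf : ∀ s ∈ Set.Ici (0:ℝ), HasDerivWithinAt f 0 (Set.Ici 0) s) {s : ℝ} (hs : 0 ≤ s) :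
    f s = f 0 := by
  have h := (convex_Ici (0:ℝ)).norm_image_sub_le_of_norm_hasDerivWithin_le
    (f' := fun _ => 0) (C := 0) hf (fun _ _ => by simp) Set.self_mem_Ici hs
  simpa [sub_eq_zero] using h

/-- There is no solution on `[0,∞)` of the geodesic system `t'' = -e^{2t}·(x')²`,
`x'' = -2 t' x'` which is past-directed unit-speed timelike and not normal to the slices:
`-(t'(0))² + e^{2 t(0)}·(x'(0))² = -1`, `t'(0) < 0`, `x'(0) ≠ 0`. -/
theorem stmt_3 :
    ¬ ∃ (t x t' x' : ℝ → ℝ),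
      (∀ s ∈ Set.Ici (0:ℝ), HasDerivWithinAt t (t' s) (Set.Ici 0) s) ∧
      (∀ s ∈ Set.Ici (0:ℝ), HasDerivWithinAt x (x' s) (Set.Ici 0) s) ∧
      (∀ s ∈ Set.Ici (0:ℝ),
        HasDerivWithinAt t' (-Real.exp (2 * t s) * (x' s) ^ 2) (Set.Ici 0) s) ∧
      (∀ s ∈ Set.Ici (0:ℝ),
        HasDerivWithinAt x' (-2 * t' s * x' s) (Set.Ici 0) s) ∧
      -(t' 0) ^ 2 + Real.exp (2 * t 0) * (x' 0) ^ 2 = -1 ∧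
      t' 0 < 0 ∧ x' 0 ≠ 0 := by
  rintro ⟨t, x, t', x', ht, -, ht', hx', h0, hneg, hne⟩
  have energy : ∀ s ∈ Set.Ici (0:ℝ), -(t' s) ^ 2 + Real.exp (2 * t s) * (x' s) ^ 2 = -1 := by
    intro s hs
    rw [← h0]
    refine eq_apply_zero_of_hasDerivWithinAt_zero
      (f := fun s => -(t' s) ^ 2 + Real.exp (2 * t s) * (x' s) ^ 2) (fun r hr => ?_) hs
    refine (((ht' r hr).fun_pow 2).fun_neg.fun_add
      (((ht r hr).const_mul 2).exp.fun_mul ((hx' r hr).fun_pow 2))).congr_deriv ?_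
    norm_num
    ring
  have growing : ∀ s ∈ Set.Ici (0:ℝ),
      Real.exp (t s - s) * (1 + t' s) = Real.exp (t 0 - 0) * (1 + t' 0) := by
    intro s hs
    refine eq_apply_zero_of_hasDerivWithinAt_zero
      (f := fun s => Real.exp (t s - s) * (1 + t' s)) (fun r hr => ?_) hs
    refine (((ht r hr).fun_sub (hasDerivAt_id' r).hasDerivWithinAt).exp.fun_mul
      ((ht' r hr).const_add 1)).congr_deriv ?_
    linear_combination -Real.exp (t r - r) * energy r hr
  have decaying : ∀ s ∈ Set.Ici (0:ℝ),
      Real.exp (t s + s) * (1 - t' s) = Real.exp (t 0 + 0) * (1 - t' 0) := by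
    intro s hs
    refine eq_apply_zero_of_hasDerivWithinAt_zero
      (f := fun s => Real.exp (t s + s) * (1 - t' s)) (fun r hr => ?_) hs
    refine (((ht r hr).fun_add (hasDerivAt_id' r).hasDerivWithinAt).exp.fun_mul
      ((ht' r hr).const_sub 1)).congr_deriv ?_
    linear_combination Real.exp (t r + r) * energy r hr
  have hlt : t' 0 < -1 := by
    have : 0 < Real.exp (2 * t 0) * (x' 0) ^ 2 := by positivity
    nlinarith
  -- Since `e ^ t` equals `e ^ (t 0) * (cosh s + t' 0 * sinh s)`, it would vanish in finite time.
  obtain ⟨s, hs0, hs⟩ : ∃ s : ℝ, 0 ≤ s ∧ 1 - t' 0 < (-1 - t' 0) * Real.exp (2 * s) := by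
    have hpos : 0 < -1 - t' 0 := by linarith
    have hq : 0 ≤ (1 - t' 0) / (-1 - t' 0) := div_nonneg (by linarith) hpos.le
    refine ⟨_, hq, ?_⟩
    rw [← div_lt_iff₀' hpos]
    linarith [Real.add_one_le_exp (2 * ((1 - t' 0) / (-1 - t' 0)))]
  have hg := growing s hs0
  have hd := decaying s hs0
  rw [sub_zero] at hg
  rw [add_zero] at hd
  have hsplit : Real.exp (t s + s) = Real.exp (t s - s) * Real.exp (2 * s) := by
    rw [← Real.exp_add]
    ring_nf
  have hsum : 2 * Real.exp (t s + s) =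
      Real.exp (t 0) * ((1 - t' 0) - (-1 - t' 0) * Real.exp (2 * s)) := by
    linear_combination (1 + t' s) * hsplit + Real.exp (2 * s) * hg + hd
  have hlhs := Real.exp_pos (t s + s)
  have hrhs := mul_neg_of_pos_of_neg (Real.exp_pos (t 0)) (sub_neg.mpr hs)
  linarith
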